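/- arXiv:1903.01417 — 5 statements merged into one kernel-verified Lean document; each statement's English description precedes it below -/
import Mathlib

section
/- Let f : ℝ → ℝ² and a ≤ b. If each of the two coordinate functions of f is monotone on [a,b] (each either nondecreasing or nonincreasing), then the total variation of f on [a,b] with respect to the L1 metric equals ‖f(b) − f(a)‖₁. (This is the paper's claim that an xy-monotone path is a shortest path: its L1 length equals the L1 distance between its endpoints.) -/
open scoped ENNReal

/-- The plane with the `L1` norm. -/
abbrev Plane := WithLp 1 (ℝ × ℝ)

/-- First coordinate of a point of the plane. -/
noncomputable def xCoord (c : Plane) : ℝ := (WithLp.equiv 1 (ℝ × ℝ) c).1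

/-- Second coordinate of a point of the plane. -/
noncomputable def yCoord (c : Plane) : ℝ := (WithLp.equiv 1 (ℝ × ℝ) c).2

theorem edist_plane_eq_add (p q : Plane) :
    edist p q = edist (xCoord p) (xCoord q) + edist (yCoord p) (yCoord q) :=
  WithLp.prod_edist_eq_of_L1 p q

theorem MonotoneOn.eVariationOn_Icc_eq_edist {g : ℝ → ℝ} {a b : ℝ} (hab : a ≤ b)
    (hg : MonotoneOn g (Set.Icc a b)) :
    eVariationOn g (Set.Icc a b) = edist (g b) (g a) := by
  have ha := Set.left_mem_Icc.2 hab
  have hb := Set.right_mem_Icc.2 hab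
  have h := hg.eVariationOn_eq ha hb
  rw [Set.inter_self] at h
  rw [h, edist_dist, Real.dist_eq, abs_of_nonneg (sub_nonneg.2 (hg ha hb hab))]

theorem AntitoneOn.eVariationOn_Icc_eq_edist {g : ℝ → ℝ} {a b : ℝ} (hab : a ≤ b)
    (hg : AntitoneOn g (Set.Icc a b)) :
    eVariationOn g (Set.Icc a b) = edist (g b) (g a) := by
  have h := MonotoneOn.eVariationOn_Icc_eq_edist hab hg.neg
  simpa only [eVariationOn, Pi.neg_apply, edist_neg_neg] using h

theorem eVariationOn_plane_le_add (f : ℝ → Plane) (s : Set ℝ) :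
    eVariationOn f s ≤
      eVariationOn (fun t => xCoord (f t)) s + eVariationOn (fun t => yCoord (f t)) s := by
  refine iSup_le fun p => ?_
  simp only [edist_plane_eq_add, Finset.sum_add_distrib]
  exact add_le_add (eVariationOn.sum_le (f := fun t => xCoord (f t)) p.2.2.1 (fun i => p.2.2.2 i))
    (eVariationOn.sum_le (f := fun t => yCoord (f t)) p.2.2.1 (fun i => p.2.2.2 i))

/-- An xy-monotone curve on `[a,b]` is a shortest path: its L1 length (total variation)
equals the L1 distance between its endpoints. -/
theorem eVariationOn_of_xy_monotone (f : ℝ → Plane) (a b : ℝ) (hab : a ≤ b)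
    (hx : MonotoneOn (fun t => xCoord (f t)) (Set.Icc a b) ∨
          AntitoneOn (fun t => xCoord (f t)) (Set.Icc a b))
    (hy : MonotoneOn (fun t => yCoord (f t)) (Set.Icc a b) ∨
          AntitoneOn (fun t => yCoord (f t)) (Set.Icc a b)) :
    eVariationOn f (Set.Icc a b) = ENNReal.ofReal ‖f b - f a‖ := by
  rw [← dist_eq_norm, ← edist_dist]
  refine le_antisymm ?_
    (eVariationOn.edist_le f (Set.right_mem_Icc.2 hab) (Set.left_mem_Icc.2 hab))
  rw [edist_plane_eq_add,
    ← hx.elim (MonotoneOn.eVariationOn_Icc_eq_edist hab) (AntitoneOn.eVariationOn_Icc_eq_edist hab),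
    ← hy.elim (MonotoneOn.eVariationOn_Icc_eq_edist hab) (AntitoneOn.eVariationOn_Icc_eq_edist hab)]
  exact eVariationOn_plane_le_add f _
end

section
/- For any function f : ℝ → ℝ² and any set s ⊆ ℝ, the total variation of f on s with respect to the L1 metric equals the sum of the total variation on s of the first coordinate function of f and the total variation on s of the second coordinate function of f (each with respect to the standard metric on ℝ). -/
open scoped ENNReal

theorem edist_eq_edist_xCoord_add_edist_yCoord (a b : Plane) :
    edist a b = edist (xCoord a) (xCoord b) + edist (yCoord a) (yCoord b) :=
  WithLp.prod_edist_eq_of_L1 a b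

theorem Finset.exists_monotone_image_Iic_eq {α : Type*} [LinearOrder α] (s : Finset α)
    (hs : s.Nonempty) :
    ∃ (k : ℕ) (w : ℕ → α), Monotone w ∧ (∀ i, w i ∈ s) ∧ w '' Set.Iic k = s := by
  have hpos := s.card_pos.2 hs
  refine ⟨s.card - 1, fun n => s.orderEmbOfFin rfl ⟨min n (s.card - 1), by omega⟩,
    fun a b hab => (s.orderEmbOfFin rfl).monotone (min_le_min_right _ hab),
    fun i => s.orderEmbOfFin_mem rfl _, ?_⟩
  ext x
  rw [← s.range_orderEmbOfFin rfl]
  constructor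
  · rintro ⟨i, -, rfl⟩
    exact ⟨_, rfl⟩
  · rintro ⟨i, rfl⟩
    exact ⟨i, Set.mem_Iic.2 (by omega), congrArg _ (Fin.ext (min_eq_left (by omega)))⟩

/-- The variation sum along a monotone sequence is at most the one along any monotone sequence
refining it. -/
theorem sum_edist_le_sum_edist_of_image_subset {α E : Type*} [LinearOrder α]
    [PseudoEMetricSpace E] (f : α → E) {u w : ℕ → α} {n k : ℕ} (hu : Monotone u)
    (hw : Monotone w) (h : u '' Set.Iic n ⊆ w '' Set.Iic k) :
    ∑ i ∈ Finset.range n, edist (f (u (i + 1))) (f (u i)) ≤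
      ∑ i ∈ Finset.range k, edist (f (w (i + 1))) (f (w i)) := by
  simpa only [eVariationOn.image_range_of_monotone f hu, eVariationOn.image_range_of_monotone f hw,
    edist_comm] using eVariationOn.mono f h

/-- Any two monotone sequences in a set have a common monotone refinement, as far as finitely many
of their terms are concerned. -/
theorem exists_monotone_refinement {α : Type*} [LinearOrder α] {s : Set α} {u v : ℕ → α}
    (hu : ∀ i, u i ∈ s) (hv : ∀ i, v i ∈ s) (n m : ℕ) :
    ∃ (k : ℕ) (w : ℕ → α), Monotone w ∧ (∀ i, w i ∈ s) ∧
      u '' Set.Iic n ⊆ w '' Set.Iic k ∧ v '' Set.Iic m ⊆ w '' Set.Iic k := by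
  obtain ⟨k, w, hw, hmem, himage⟩ := Finset.exists_monotone_image_Iic_eq
    ((Finset.Iic n).image u ∪ (Finset.Iic m).image v)
    ⟨u 0, Finset.mem_union_left _ (Finset.mem_image_of_mem u (by simp))⟩
  refine ⟨k, w, hw, fun i => ?_, ?_, ?_⟩
  · rcases Finset.mem_union.1 (hmem i) with h | h <;>
      obtain ⟨j, -, hj⟩ := Finset.mem_image.1 h
    · exact hj ▸ hu j
    · exact hj ▸ hv j
  · simp [himage]
  · simp [himage]

/-- The total variation of a planar curve with respect to the L1 metric is the sum of the
total variations of its two coordinate functions. -/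
theorem eVariationOn_eq_add_coords (f : ℝ → Plane) (s : Set ℝ) :
    eVariationOn f s =
      eVariationOn (fun t => xCoord (f t)) s + eVariationOn (fun t => yCoord (f t)) s := by
  simp only [eVariationOn, edist_eq_edist_xCoord_add_edist_yCoord, Finset.sum_add_distrib]
  refine (ENNReal.iSup_add_iSup ?_).symm
  rintro ⟨n, u, hu, hus⟩ ⟨m, v, hv, hvs⟩
  obtain ⟨k, w, hw, hws, huw, hvw⟩ := exists_monotone_refinement hus hvs n m
  exact ⟨⟨k, w, hw, hws⟩, add_le_add
    (sum_edist_le_sum_edist_of_image_subset (fun t => xCoord (f t)) hu hw huw)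
    (sum_edist_le_sum_edist_of_image_subset (fun t => yCoord (f t)) hv hw hvw)⟩
end

section
/- Let γ : [0,1] → ℝ² be a function with γ(0) = a and γ(1) = b whose total variation on [0,1] with respect to the L1 metric equals ‖a − b‖₁. Then γ(t) ∈ Box(a,b) for every t ∈ [0,1]; i.e., L1 geodesics stay inside the axis-parallel bounding rectangle of their endpoints. -/
open scoped ENNReal

/-- The closed axis-parallel rectangle with `a` and `b` as opposite corners. -/
def Box (a b : Plane) : Set Plane :=
  {c | xCoord c ∈ Set.uIcc (xCoord a) (xCoord b) ∧
       yCoord c ∈ Set.uIcc (yCoord a) (yCoord b)}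

theorem dist_eq_abs_add_abs (a b : Plane) :
    dist a b = |xCoord a - xCoord b| + |yCoord a - yCoord b| := by
  rw [WithLp.prod_dist_eq_add (by simp)]
  simp [Real.dist_eq, xCoord, yCoord]

theorem mem_uIcc_of_abs_add_abs_le {x y z : ℝ} (h : |x - z| + |z - y| ≤ |x - y|) :
    z ∈ Set.uIcc x y := by
  rw [Set.mem_uIcc]
  grind

/-- Points realizing equality in the triangle inequality lie in the bounding rectangle. -/
theorem mem_Box_of_dist_add_dist_le {a b c : Plane} (h : dist a c + dist c b ≤ dist a b) :
    c ∈ Box a b := by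
  simp only [dist_eq_abs_add_abs] at h
  have hx := abs_sub_le (xCoord a) (xCoord c) (xCoord b)
  have hy := abs_sub_le (yCoord a) (yCoord c) (yCoord b)
  exact ⟨mem_uIcc_of_abs_add_abs_le (by linarith), mem_uIcc_of_abs_add_abs_le (by linarith)⟩

theorem edist_add_edist_le_eVariationOn_Icc {α E : Type*} [LinearOrder α] [PseudoEMetricSpace E]
    (f : α → E) {x y t : α} (ht : t ∈ Set.Icc x y) :
    edist (f x) (f t) + edist (f t) (f y) ≤ eVariationOn f (Set.Icc x y) := by
  have h := eVariationOn.Icc_add_Icc f (s := Set.univ) ht.1 ht.2 (Set.mem_univ t)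
  simp only [Set.univ_inter] at h
  rw [← h]
  exact add_le_add
    (eVariationOn.edist_le f (Set.left_mem_Icc.2 ht.1) (Set.right_mem_Icc.2 ht.1))
    (eVariationOn.edist_le f (Set.left_mem_Icc.2 ht.2) (Set.right_mem_Icc.2 ht.2))

/-- L1 geodesics stay in the axis-parallel bounding rectangle of their endpoints: if the
total variation of `γ` on `[0,1]` w.r.t. the L1 metric equals `‖a - b‖₁`, then every point
`γ t` with `t ∈ [0,1]` lies in `Box(a,b)`. -/
theorem geodesic_mem_box (a b : Plane) (γ : ℝ → Plane)
    (h0 : γ 0 = a) (h1 : γ 1 = b)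
    (hlen : eVariationOn γ (Set.Icc 0 1) = ENNReal.ofReal ‖a - b‖) :
    ∀ t ∈ Set.Icc (0 : ℝ) 1, γ t ∈ Box a b := by
  intro t ht
  have h := edist_add_edist_le_eVariationOn_Icc γ ht
  rw [hlen, h0, h1, edist_dist, edist_dist, ← ENNReal.ofReal_add dist_nonneg dist_nonneg,
    ← dist_eq_norm, ENNReal.ofReal_le_ofReal_iff dist_nonneg] at h
  exact mem_Box_of_dist_add_dist_le h
end

section
/- Let a, b ∈ ℝ² have equal first coordinates, and let γ : [0,1] → ℝ² be a path from a to b whose L1 length equals ‖a − b‖₁ (= the absolute difference of the second coordinates). Then the image of γ equals the closed segment [a,b]. The analogous statement holds when a and b have equal second coordinates. (Hence a vertical or horizontal segment is the unique shortest-path image between its endpoints, as used in Lemma 2(5) of the paper.) -/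
open scoped ENNReal

/-- A point of the plane lying metrically between two points that share a coordinate
lies on the segment joining them. -/
theorem mem_segment_of_dist_add_dist_le {a b p : Plane}
    (hax : xCoord a = xCoord b ∨ yCoord a = yCoord b)
    (h : dist a p + dist p b ≤ dist a b) : p ∈ segment ℝ a b := by
  simp only [WithLp.prod_dist_eq_of_L1] at h
  have hx : dist a.fst p.fst + dist p.fst b.fst = dist a.fst b.fst := by
    linarith [dist_triangle a.fst p.fst b.fst, dist_triangle a.snd p.snd b.snd]
  have hy : dist a.snd p.snd + dist p.snd b.snd = dist a.snd b.snd := by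
    linarith [dist_triangle a.fst p.fst b.fst, dist_triangle a.snd p.snd b.snd]
  obtain ⟨s, hs, hsp⟩ := dist_add_dist_eq_iff.mp hx
  obtain ⟨t, ht, htp⟩ := dist_add_dist_eq_iff.mp hy
  rw [segment_eq_image_lineMap]
  simp only [AffineMap.lineMap_apply, vsub_eq_sub, vadd_eq_add, smul_eq_mul] at hsp htp
  rcases hax with hax | hax
  · have hab : a.fst = b.fst := hax
    refine ⟨t, ht, WithLp.ofLp_injective 1 (Prod.ext ?_ ?_)⟩
    · simpa [AffineMap.lineMap_apply, hab] using hsp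
    · simpa [AffineMap.lineMap_apply] using htp
  · have hab : a.snd = b.snd := hax
    refine ⟨s, hs, WithLp.ofLp_injective 1 (Prod.ext ?_ ?_)⟩
    · simpa [AffineMap.lineMap_apply] using hsp
    · simpa [AffineMap.lineMap_apply, hab] using htp

/-- A preconnected subset of a segment containing both endpoints is the whole segment. -/
theorem IsPreconnected.eq_segment {E : Type*} [NormedAddCommGroup E] [NormedSpace ℝ E]
    {S : Set E} {a b : E} (hS : IsPreconnected S) (ha : a ∈ S) (hb : b ∈ S)
    (hsub : S ⊆ segment ℝ a b) : S = segment ℝ a b := by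
  refine hsub.antisymm ?_
  rcases eq_or_ne a b with rfl | hab
  · simpa using ha
  intro q hq
  rw [segment_eq_image_lineMap] at hq hsub
  obtain ⟨t, ht, rfl⟩ := hq
  have hivt := hS.intermediate_value ha hb (f := fun z => dist z a) (by fun_prop)
  obtain ⟨p, hp, hpt⟩ : t * dist a b ∈ (fun z => dist z a) '' S := by
    refine hivt ⟨?_, ?_⟩
    · simpa using mul_nonneg ht.1 dist_nonneg
    · simpa [dist_comm b a] using mul_le_of_le_one_left dist_nonneg ht.2
  obtain ⟨s, hs, rfl⟩ := hsub hp
  have hst : s = t := by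
    simp only [dist_lineMap_left, Real.norm_of_nonneg hs.1] at hpt
    exact mul_right_cancel₀ (dist_ne_zero.mpr hab) hpt
  exact hst ▸ hp

/-- On a path whose variation is the distance of its endpoints, the triangle inequality
through any intermediate point is an equality. -/
theorem dist_add_dist_le_of_eVariationOn_le {α E : Type*} [LinearOrder α] [PseudoMetricSpace E]
    {f : α → E} {x y t : α} (ht : t ∈ Set.Icc x y)
    (h : eVariationOn f (Set.Icc x y) ≤ ENNReal.ofReal (dist (f x) (f y))) :
    dist (f x) (f t) + dist (f t) (f y) ≤ dist (f x) (f y) := by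
  have hadd := eVariationOn.Icc_add_Icc f (s := Set.univ) ht.1 ht.2 (Set.mem_univ t)
  simp only [Set.univ_inter] at hadd
  have hle : edist (f x) (f t) + edist (f t) (f y) ≤ ENNReal.ofReal (dist (f x) (f y)) :=
    (add_le_add
      (eVariationOn.edist_le f (Set.left_mem_Icc.mpr ht.1) (Set.right_mem_Icc.mpr ht.1))
      (eVariationOn.edist_le f (Set.left_mem_Icc.mpr ht.2) (Set.right_mem_Icc.mpr ht.2))).trans
      (hadd.trans_le h)
  rw [edist_dist, edist_dist, ← ENNReal.ofReal_add dist_nonneg dist_nonneg] at hle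
  exact (ENNReal.ofReal_le_ofReal_iff dist_nonneg).mp hle

/-- A vertical or horizontal segment is the unique shortest-path image between its
endpoints: if `a` and `b` share their first (or, analogously, their second) coordinate and
`γ` is a path from `a` to `b` of L1 length `‖a - b‖₁`, then the image of `γ` on `[0,1]`
is exactly the closed segment from `a` to `b`. -/
theorem image_eq_segment_of_axis_aligned (a b : Plane)
    (hax : xCoord a = xCoord b ∨ yCoord a = yCoord b)
    (γ : ℝ → Plane) (hcont : ContinuousOn γ (Set.Icc 0 1))
    (h0 : γ 0 = a) (h1 : γ 1 = b)
    (hlen : eVariationOn γ (Set.Icc 0 1) = ENNReal.ofReal ‖a - b‖) :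
    γ '' Set.Icc 0 1 = segment ℝ a b := by
  subst h0 h1
  refine (isPreconnected_Icc.image γ hcont).eq_segment
    ⟨0, by simp, rfl⟩ ⟨1, by simp, rfl⟩ ?_
  rintro _ ⟨t, ht, rfl⟩
  refine mem_segment_of_dist_add_dist_le hax (dist_add_dist_le_of_eVariationOn_le ht ?_)
  rw [hlen, dist_eq_norm]
end

section
/- Let S ⊆ ℝ², let s, t ∈ S, and let p ∈ Box(s,t) be such that the closed segments [s,p] and [p,t] are contained in S. Then d_S(s,t) = ‖s − p‖₁ + ‖p − t‖₁ = ‖s − t‖₁; in particular, the two-segment polyline from s through p to t is a shortest path from s to t in S. (This is the core of the paper's Lemma 3: if t is in the first quadrant of p and s is in the third quadrant of p, then sp ∪ pt is a shortest s–t path.) -/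
open scoped ENNReal

/-- A path from `p` to `q` in a set `S`: a continuous map on `[0,1]` with the prescribed
endpoints whose image on `[0,1]` lies in `S`. -/
def IsPathIn (S : Set Plane) (p q : Plane) (γ : ℝ → Plane) : Prop :=
  ContinuousOn γ (Set.Icc 0 1) ∧ γ 0 = p ∧ γ 1 = q ∧ γ '' Set.Icc 0 1 ⊆ S

/-- The L1 length of a path: its total variation on `[0,1]` w.r.t. the L1 metric. -/
noncomputable def pathLength (γ : ℝ → Plane) : ℝ≥0∞ := eVariationOn γ (Set.Icc 0 1)

/-- Geodesic L1 distance inside `S`: the infimum of the L1 lengths of paths in `S`. -/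
noncomputable def geoDist (S : Set Plane) (p q : Plane) : ℝ≥0∞ :=
  ⨅ (γ : ℝ → Plane) (_ : IsPathIn S p q γ), pathLength γ

/-- A map `γ : [0,1] → ℝ²` is xy-monotone if each of its two coordinate functions is
monotone (nondecreasing or nonincreasing) on `[0,1]`. -/
def XYMonotone (γ : ℝ → Plane) : Prop :=
  (MonotoneOn (fun t => xCoord (γ t)) (Set.Icc 0 1) ∨
    AntitoneOn (fun t => xCoord (γ t)) (Set.Icc 0 1)) ∧
  (MonotoneOn (fun t => yCoord (γ t)) (Set.Icc 0 1) ∨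
    AntitoneOn (fun t => yCoord (γ t)) (Set.Icc 0 1))

/-- The two-segment polyline from `s` through `p` to `t`, parametrized on `[0,1]`. -/
noncomputable def polyline (s p t : Plane) : ℝ → Plane := fun u =>
  if u ≤ 1 / 2 then (1 - 2 * u) • s + (2 * u) • p else (2 - 2 * u) • p + (2 * u - 1) • t

theorem norm_sub_add_norm_sub_of_mem_Box {s t p : Plane} (hp : p ∈ Box s t) :
    ‖s - p‖ + ‖p - t‖ = ‖s - t‖ := by
  have abs_add {a b c : ℝ} (h : c ∈ Set.uIcc a b) : |a - c| + |c - b| = |a - b| := by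
    rcases Set.mem_uIcc.1 h with ⟨h1, h2⟩ | ⟨h1, h2⟩
    · rw [abs_of_nonpos, abs_of_nonpos, abs_of_nonpos] <;> linarith
    · rw [abs_of_nonneg, abs_of_nonneg, abs_of_nonneg] <;> linarith
  have hx : |s.fst - p.fst| + |p.fst - t.fst| = |s.fst - t.fst| := abs_add hp.1
  have hy : |s.snd - p.snd| + |p.snd - t.snd| = |s.snd - t.snd| := abs_add hp.2
  simp only [WithLp.prod_norm_eq_of_L1, WithLp.sub_fst, WithLp.sub_snd, Real.norm_eq_abs]
  linarith

theorem edist_le_pathLength {S : Set Plane} {p q : Plane} {γ : ℝ → Plane}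
    (h : IsPathIn S p q γ) : edist p q ≤ pathLength γ := by
  obtain ⟨-, h0, h1, -⟩ := h
  rw [← h0, ← h1]
  exact eVariationOn.edist_le γ (by simp) (by simp)

theorem edist_le_geoDist (S : Set Plane) (p q : Plane) : edist p q ≤ geoDist S p q :=
  le_iInf₂ fun _ h => edist_le_pathLength h

theorem geoDist_le_pathLength {S : Set Plane} {p q : Plane} {γ : ℝ → Plane}
    (h : IsPathIn S p q γ) : geoDist S p q ≤ pathLength γ :=
  iInf₂_le γ h

theorem eVariationOn_lineMap_comp_le (p q : Plane) {g : ℝ → ℝ} {a b : ℝ} (hab : a ≤ b)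
    (hg : MonotoneOn g (Set.Icc a b)) (h1 : g b - g a = 1) :
    eVariationOn (AffineMap.lineMap p q ∘ g) (Set.Icc a b) ≤ edist p q := by
  have hv := hg.eVariationOn_eq (Set.left_mem_Icc.2 hab) (Set.right_mem_Icc.2 hab)
  rw [Set.inter_self, h1, ENNReal.ofReal_one] at hv
  calc eVariationOn (AffineMap.lineMap p q ∘ g) (Set.Icc a b)
      ≤ nndist p q * eVariationOn g (Set.Icc a b) :=
        (lipschitzWith_lineMap p q).lipschitzOnWith.comp_eVariationOn_le (Set.mapsTo_univ _ _)
    _ = nndist p q * 1 := by rw [hv]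
    _ = edist p q := by rw [mul_one, edist_nndist]

theorem polyline_eq_lineMap_of_le (s p t : Plane) {u : ℝ} (hu : u ≤ 1 / 2) :
    polyline s p t u = AffineMap.lineMap s p (2 * u) := by
  rw [polyline, if_pos hu, AffineMap.lineMap_apply_module]

theorem polyline_eq_lineMap_of_ge (s p t : Plane) {u : ℝ} (hu : 1 / 2 ≤ u) :
    polyline s p t u = AffineMap.lineMap p t (2 * u - 1) := by
  rcases hu.eq_or_lt with rfl | hu
  · rw [polyline_eq_lineMap_of_le s p t le_rfl]
    norm_num
  · rw [polyline, if_neg hu.not_ge, AffineMap.lineMap_apply_module]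
    congr 2
    ring

theorem continuous_polyline (s p t : Plane) : Continuous (polyline s p t) := by
  unfold polyline
  refine Continuous.if_le (by fun_prop) (by fun_prop) continuous_id continuous_const ?_
  rintro u rfl
  norm_num

theorem isPathIn_polyline {S : Set Plane} {s p t : Plane}
    (h1 : segment ℝ s p ⊆ S) (h2 : segment ℝ p t ⊆ S) :
    IsPathIn S s t (polyline s p t) := by
  refine ⟨(continuous_polyline s p t).continuousOn, by norm_num [polyline],
    by norm_num [polyline], ?_⟩
  rintro _ ⟨u, ⟨hu0, hu1⟩, rfl⟩
  rcases le_total u (1 / 2) with hu | hu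
  · rw [polyline_eq_lineMap_of_le s p t hu]
    exact h1 (lineMap_mem_segment ℝ s p ⟨by linarith, by linarith⟩)
  · rw [polyline_eq_lineMap_of_ge s p t hu]
    exact h2 (lineMap_mem_segment ℝ p t ⟨by linarith, by linarith⟩)

theorem pathLength_polyline_le (s p t : Plane) :
    pathLength (polyline s p t) ≤ edist s p + edist p t := by
  have hsplit := eVariationOn.Icc_add_Icc (polyline s p t) (s := Set.univ)
    (a := 0) (b := 1 / 2) (c := 1) (by norm_num) (by norm_num) (Set.mem_univ _)
  simp only [Set.univ_inter] at hsplit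
  rw [pathLength, ← hsplit]
  gcongr
  · rw [eVariationOn.eq_of_eqOn (f' := AffineMap.lineMap s p ∘ fun u : ℝ => 2 * u)
      fun u hu => polyline_eq_lineMap_of_le s p t hu.2]
    refine eVariationOn_lineMap_comp_le s p (by norm_num) ?_ (by norm_num)
    intro a _ b _ hab
    dsimp only
    linarith
  · rw [eVariationOn.eq_of_eqOn (f' := AffineMap.lineMap p t ∘ fun u : ℝ => 2 * u - 1)
      fun u hu => polyline_eq_lineMap_of_ge s p t hu.1]
    refine eVariationOn_lineMap_comp_le p t (by norm_num) ?_ (by norm_num)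
    intro a _ b _ hab
    dsimp only
    linarith

/-- If `p ∈ Box(s,t)` and the segments `[s,p]` and `[p,t]` lie in `S`, then
`d_S(s,t) = ‖s - p‖₁ + ‖p - t‖₁ = ‖s - t‖₁`, and the polyline `s → p → t` is a shortest
path from `s` to `t` in `S`. -/
theorem geoDist_via_corner (S : Set Plane) (s t p : Plane)
    (hs : s ∈ S) (ht : t ∈ S) (hp : p ∈ Box s t)
    (h1 : segment ℝ s p ⊆ S) (h2 : segment ℝ p t ⊆ S) :
    geoDist S s t = ENNReal.ofReal (‖s - p‖ + ‖p - t‖) ∧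
    ‖s - p‖ + ‖p - t‖ = ‖s - t‖ ∧
    IsPathIn S s t (polyline s p t) ∧
    pathLength (polyline s p t) = geoDist S s t := by
  have hnorm := norm_sub_add_norm_sub_of_mem_Box hp
  have hpath := isPathIn_polyline h1 h2
  have hle : pathLength (polyline s p t) ≤ edist s t := by
    refine (pathLength_polyline_le s p t).trans_eq ?_
    rw [edist_dist, edist_dist, edist_dist, ← ENNReal.ofReal_add dist_nonneg dist_nonneg,
      dist_eq_norm, dist_eq_norm, dist_eq_norm, hnorm]
  have hgeo : geoDist S s t = edist s t :=
    le_antisymm ((geoDist_le_pathLength hpath).trans hle) (edist_le_geoDist S s t)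
  refine ⟨?_, hnorm, hpath, ?_⟩
  · rw [hgeo, hnorm, edist_dist, dist_eq_norm]
  · exact le_antisymm (hle.trans_eq hgeo.symm) (geoDist_le_pathLength hpath)
end
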